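/- Let (u*, v*) be the unconstrained minimizer of the regularized objective f(u,v) = (1/2)Σ_{i,j}A_{ij}²e^{2u_i+2v_j} − α²·1ᵀu − β²·1ᵀv + (γ/2)(‖u‖₂²+‖v‖₂²) with mα² = nβ². Then γ·(1ᵀu* − 1ᵀv*) = 0, i.e., 1ᵀu* = 1ᵀv*, so the products of the diagonal entries of D = diag(e^{u*}) and E = diag(e^{v*}) are equal: ∏ᵢ D_{ii} = ∏ⱼ E_{jj}. -/

import Mathlib

/-- A real quadratic without constant term that is nonnegative everywhere has no linear term. -/
theorem linear_coeff_eq_zero_of_quadratic_nonneg {d N : ℝ} (hN : 0 ≤ N)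
    (h : ∀ t : ℝ, 0 ≤ 2 * t * d + t ^ 2 * N) : d = 0 := by
  have h1 := h (-d / (N + 1))
  have hN1 : 0 < N + 1 := by linarith
  have h2 : 2 * (-d / (N + 1)) * d + (-d / (N + 1)) ^ 2 * N
      = -(d ^ 2 * (N + 2)) / (N + 1) ^ 2 := by
    field_simp
    ring
  rw [h2, le_div_iff₀ (by positivity)] at h1
  have h3 : d ^ 2 = 0 := by nlinarith [sq_nonneg d, mul_nonneg (sq_nonneg d) hN]
  exact pow_eq_zero_iff two_ne_zero |>.mp h3

/-- Expansion of the sum of squares of a vector translated by a constant. -/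
theorem sum_add_const_sq {k : ℕ} (x : Fin k → ℝ) (t : ℝ) :
    ∑ i, (x i + t) ^ 2 = ∑ i, (x i) ^ 2 + 2 * t * ∑ i, x i + k * t ^ 2 := by
  simp only [add_sq, Finset.sum_add_distrib, Finset.mul_sum, Finset.sum_const, Finset.card_univ,
    Fintype.card_fin, nsmul_eq_mul]
  congr 2
  exact Finset.sum_congr rfl fun i _ => by ring

/-- At the unconstrained minimizer `(u*, v*)` of the regularized objective with
`mα² = nβ²`, one has `1ᵀu* = 1ᵀv*`, so the products of the diagonal entries of
`D = diag(e^{u*})` and `E = diag(e^{v*})` are equal. -/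
theorem regularized_minimizer_balanced {m n : ℕ} (A : Matrix (Fin m) (Fin n) ℝ)
    (α β γ : ℝ) (hα : 0 < α) (hβ : 0 < β) (hγ : 0 < γ)
    (hmn : (m : ℝ) * α ^ 2 = (n : ℝ) * β ^ 2)
    (u : Fin m → ℝ) (v : Fin n → ℝ)
    (hmin : ∀ (u' : Fin m → ℝ) (v' : Fin n → ℝ),
      (1 / 2) * ∑ i, ∑ j, (A i j) ^ 2 * Real.exp (2 * u i + 2 * v j)
          - α ^ 2 * ∑ i, u i - β ^ 2 * ∑ j, v j
          + (γ / 2) * ((∑ i, (u i) ^ 2) + ∑ j, (v j) ^ 2) ≤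
      (1 / 2) * ∑ i, ∑ j, (A i j) ^ 2 * Real.exp (2 * u' i + 2 * v' j)
          - α ^ 2 * ∑ i, u' i - β ^ 2 * ∑ j, v' j
          + (γ / 2) * ((∑ i, (u' i) ^ 2) + ∑ j, (v' j) ^ 2)) :
    (∑ i, u i) = (∑ j, v j) ∧
    (∏ i, Real.exp (u i)) = ∏ j, Real.exp (v j) := by
  have hsum : (∑ i, u i) = ∑ j, v j := by
    refine sub_eq_zero.mp (linear_coeff_eq_zero_of_quadratic_nonneg
      (N := (m : ℝ) + n) (by positivity) fun t => ?_)
    have h := hmin (fun i => u i + t) (fun j => v j + -t)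
    have hexp : ∀ i j, 2 * (u i + t) + 2 * (v j + -t) = 2 * u i + 2 * v j :=
      fun i j => by ring
    simp only [hexp, sum_add_const_sq] at h
    simp only [Finset.sum_add_distrib, Finset.sum_const, Finset.card_univ, Fintype.card_fin,
      nsmul_eq_mul] at h
    have hscaled : 0 ≤ γ * (2 * t * (∑ i, u i - ∑ j, v j) + t ^ 2 * ((m : ℝ) + n)) := by
      linear_combination 2 * h - 2 * t * hmn
    exact nonneg_of_mul_nonneg_right hscaled hγ
  exact ⟨hsum, by rw [← Real.exp_sum, ← Real.exp_sum, hsum]⟩
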